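/- For each fixed τ ∈ (1/e, 1] and arbitrary α > Λ(τ) and r > τ, there exist measurable functions p, τ̄ : ℝ → ℝ with |p(t)| = 1 for all t, τ̄(t) ≤ t for all t, sup_{t ≥ 0}(t - τ̄(t)) ≤ r, and τ̄(t) → ∞ as t → ∞, together with an unbounded α-oscillating solution x of x'(t) = p(t)·x(τ̄(t)) on [0, ∞). -/

import Mathlib

open Real MeasureTheory Filter Set

noncomputable section

/-- `x` is the solution of `x'(t) = -x(t-τ)` with `x ≡ 1` on `(-∞,0]`:
`x(t) = 1 - ∫_0^t x(s-τ) ds` for `t ≥ 0`. -/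
def IsXSol (τ : ℝ) (x : ℝ → ℝ) : Prop :=
  Continuous x ∧ (∀ t ≤ (0:ℝ), x t = 1) ∧
    ∀ t ≥ (0:ℝ), x t = 1 - ∫ s in (0:ℝ)..t, x (s - τ)

/-- The first positive root of a function. -/
noncomputable def firstRoot (x : ℝ → ℝ) : ℝ := sInf {t : ℝ | 0 < t ∧ x t = 0}

/-- `ψ` is the solution of `ψ'(t) = max{x_τ(ϱ(τ)+t-τ), ψ(t)}` on `[0,τ]`,
`ψ'(t) = ψ(t)` on `[τ,∞)`, `ψ(0) = 0`. -/
def IsPsiSol (τ ρ : ℝ) (xτ ψ : ℝ → ℝ) : Prop :=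
  ContinuousOn ψ (Ici (0:ℝ)) ∧ ψ 0 = 0 ∧
    (∀ t ∈ Icc (0:ℝ) τ, ψ t = ∫ s in (0:ℝ)..t, max (xτ (ρ + s - τ)) (ψ s)) ∧
    (∀ t ≥ τ, ψ t = ψ τ + ∫ s in τ..t, ψ s)

/-- A (continuous, integrated-form) solution of the delay equation
`x'(t) = p(t) x(τ̄(t))` on `[t₀,∞)`. -/
def IsDelaySolution (p τd : ℝ → ℝ) (t₀ : ℝ) (x : ℝ → ℝ) : Prop :=
  Continuous x ∧ ∀ t ≥ t₀, x t = x t₀ + ∫ s in t₀..t, p s * x (τd s)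

/-- `x` is `α`-oscillating: eventually every interval on which `x` has no zero
has length at most `α`. -/
def AlphaOscillating (α : ℝ) (x : ℝ → ℝ) : Prop :=
  ∃ T : ℝ, ∀ a b : ℝ, T ≤ a → a < b → (∀ t ∈ Ioo a b, x t ≠ 0) → b - a ≤ α

/-- `x` is oscillatory: it has arbitrarily large zeros. -/
def Oscillatory (x : ℝ → ℝ) : Prop := ∀ T : ℝ, ∃ t ≥ T, x t = 0


lemma IsXSol.hasDerivAt {τ : ℝ} {x : ℝ → ℝ} (hx : IsXSol τ x) {t : ℝ} (ht : 0 < t) :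
    HasDerivAt x (-x (t - τ)) t := by
  obtain ⟨hc, -, hi⟩ := hx
  have hc' : Continuous fun s => x (s - τ) := by fun_prop
  have h := (intervalIntegral.integral_hasDerivAt_right (hc'.intervalIntegrable 0 t)
    (hc'.stronglyMeasurableAtFilter _ _) hc'.continuousAt).const_sub 1
  refine h.congr_of_eventuallyEq ?_
  filter_upwards [lt_mem_nhds ht] with s hs using hi s hs.le

lemma antitoneOn_Icc_of_hasDerivAt_nonpos {f f' : ℝ → ℝ} {a b : ℝ}
    (hc : ContinuousOn f (Icc a b)) (hd : ∀ t ∈ Ioo a b, HasDerivAt f (f' t) t)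
    (hf : ∀ t ∈ Ioo a b, f' t ≤ 0) : AntitoneOn f (Icc a b) := by
  refine antitoneOn_of_deriv_nonpos (convex_Icc a b) hc ?_ ?_
  · rw [interior_Icc]
    exact fun t ht => (hd t ht).differentiableAt.differentiableWithinAt
  · rw [interior_Icc]
    intro t ht
    rw [(hd t ht).deriv]
    exact hf t ht

lemma IsXSol.exists_root {τ : ℝ} {x : ℝ → ℝ} (hx : IsXSol τ x) (hτ : 1 / Real.exp 1 < τ) :
    ∃ t, 0 < t ∧ x t = 0 := by
  have hτ0 : 0 < τ := lt_trans (by positivity) hτ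
  have hc := hx.1
  by_contra! hne
  have hpos : ∀ t, 0 < x t := by
    intro t
    rcases le_or_gt t 0 with ht | ht
    · rw [hx.2.1 t ht]; exact one_pos
    · by_contra! h
      obtain ⟨s, hs, hs0⟩ := intermediate_value_Icc' ht.le hc.continuousOn
        ⟨h, by rw [hx.2.1 0 le_rfl]; exact zero_le_one⟩
      rcases hs.1.eq_or_lt with h0 | h0
      · rw [← h0, hx.2.1 0 le_rfl] at hs0; exact one_ne_zero hs0
      · exact hne s h0 hs0
  have hanti : ∀ s t, 0 ≤ s → s ≤ t → x t ≤ x s := fun s t hs hst =>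
    antitoneOn_Icc_of_hasDerivAt_nonpos hc.continuousOn
      (fun u hu => hx.hasDerivAt (hs.trans_lt hu.1)) (fun u _ => by linarith [hpos (u - τ)])
      (left_mem_Icc.2 hst) (right_mem_Icc.2 hst) hst
  have hgrow : ∀ n : ℕ, ∀ t, (n + 1) * τ ≤ t → (Real.exp 1 * τ) ^ n * x t ≤ x (t - τ) := by
    intro n
    induction n with
    | zero =>
      intro t ht
      simp only [Nat.cast_zero, zero_add, one_mul, pow_zero] at ht ⊢
      exact hanti _ _ (by linarith) (by linarith)
    | succ n ih =>
      intro t ht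
      push_cast at ht
      set m := (Real.exp 1 * τ) ^ n
      have hn : (0 : ℝ) ≤ n * τ := by positivity
      have hle := antitoneOn_Icc_of_hasDerivAt_nonpos (a := t - τ) (b := t)
        (f := fun s => x s * Real.exp (m * s))
        (f' := fun s => -x (s - τ) * Real.exp (m * s) + x s * (Real.exp (m * s) * m))
        (by fun_prop)
        (fun s hs => by
          have hs1 := hs.1
          have he : HasDerivAt (fun s => Real.exp (m * s)) (Real.exp (m * s) * m) s := by
            simpa using ((hasDerivAt_id s).const_mul m).exp
          exact (hx.hasDerivAt (by linarith)).mul he)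
        (fun s hs => by
          have := ih s (by linarith [hs.1])
          have he := Real.exp_pos (m * s)
          nlinarith)
        (left_mem_Icc.2 (by linarith)) (right_mem_Icc.2 (by linarith)) (by linarith)
      have hsplit : Real.exp (m * t) = Real.exp (m * τ) * Real.exp (m * (t - τ)) := by
        rw [← Real.exp_add]; ring_nf
      simp only [hsplit, ← mul_assoc] at hle
      have hle' : x t * Real.exp (m * τ) ≤ x (t - τ) := le_of_mul_le_mul_right hle (Real.exp_pos _)
      have hexp : m * τ * Real.exp 1 ≤ Real.exp (m * τ) := by
        have h1 := Real.add_one_le_exp (m * τ - 1)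
        have h2 : Real.exp (m * τ) = Real.exp (m * τ - 1) * Real.exp 1 := by
          rw [← Real.exp_add]; ring_nf
        rw [h2]
        exact mul_le_mul_of_nonneg_right (by linarith) (Real.exp_pos 1).le
      calc (Real.exp 1 * τ) ^ (n + 1) * x t = x t * (m * τ * Real.exp 1) := by
            rw [pow_succ]; ring
        _ ≤ x t * Real.exp (m * τ) := mul_le_mul_of_nonneg_left hexp (hpos t).le
        _ ≤ _ := hle'
  have hhalf : ∀ s, τ ≤ s → τ / 2 * x (s - τ / 2) ≤ x s := by
    intro s hs
    have hle := antitoneOn_Icc_of_hasDerivAt_nonpos (a := s) (b := s + τ / 2)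
      (f := fun u => x u + x (s - τ / 2) * u)
      (f' := fun u => -x (u - τ) + x (s - τ / 2) * 1)
      (by fun_prop)
      (fun u hu => (hx.hasDerivAt (by linarith [hu.1])).add ((hasDerivAt_id u).const_mul _))
      (fun u hu => by
        have := hanti (u - τ) (s - τ / 2) (by linarith [hu.1]) (by linarith [hu.2])
        linarith)
      (left_mem_Icc.2 (by linarith)) (right_mem_Icc.2 (by linarith)) (by linarith)
    simp only at hle
    linarith [hpos (s + τ / 2)]
  have hbdd : ∀ n : ℕ, (Real.exp 1 * τ) ^ n * (τ / 2) ^ 2 ≤ 1 := by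
    intro n
    have hn : (0 : ℝ) ≤ n * τ := by positivity
    set t := ((n : ℝ) + 2) * τ with ht
    have h1 := hgrow n t (by linarith)
    have h2 := hhalf t (by linarith)
    have h3 := hhalf (t - τ / 2) (by linarith)
    rw [show t - τ / 2 - τ / 2 = t - τ by ring] at h3
    have h4 : (τ / 2) ^ 2 * x (t - τ) ≤ x t := by nlinarith
    have h5 : (τ / 2) ^ 2 * ((Real.exp 1 * τ) ^ n * x t) ≤ (τ / 2) ^ 2 * x (t - τ) :=
      mul_le_mul_of_nonneg_left h1 (by positivity)
    refine le_of_mul_le_mul_right (a := x t) ?_ (hpos t)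
    linarith
  have hgt : 1 < Real.exp 1 * τ := by
    rw [div_lt_iff₀ (Real.exp_pos 1)] at hτ
    linarith
  obtain ⟨n, hn⟩ := pow_unbounded_of_one_lt (1 / (τ / 2) ^ 2) hgt
  rw [div_lt_iff₀ (by positivity)] at hn
  exact absurd (hbdd n) (not_le.2 hn)

lemma IsXSol.firstRoot_spec {τ : ℝ} {x : ℝ → ℝ} (hx : IsXSol τ x)
    (hτ : τ ∈ Ioc (1 / Real.exp 1) 1) : τ ≤ firstRoot x ∧ x (firstRoot x) = 0 := by
  have hτ0 : 0 < τ := lt_trans (by positivity) hτ.1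
  have hlb : ∀ t, 0 < t → x t = 0 → τ ≤ t := by
    intro t ht h0
    by_contra! hlt
    have hone : ∫ s in (0 : ℝ)..t, x (s - τ) = ∫ _ in (0 : ℝ)..t, (1 : ℝ) := by
      refine intervalIntegral.integral_congr fun s hs => ?_
      rw [uIcc_of_le ht.le] at hs
      exact hx.2.1 _ (by linarith [hs.2])
    have := hx.2.2 t ht.le
    rw [hone, h0] at this
    simp at this
    linarith [hτ.2]
  have hset : {t : ℝ | 0 < t ∧ x t = 0} = Ici τ ∩ x ⁻¹' {0} := by
    ext t
    exact ⟨fun h => ⟨hlb t h.1 h.2, h.2⟩, fun h => ⟨hτ0.trans_le h.1, h.2⟩⟩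
  have hmem : firstRoot x ∈ Ici τ ∩ x ⁻¹' {0} := by
    unfold firstRoot
    rw [hset]
    refine (isClosed_Ici.inter (isClosed_singleton.preimage hx.1)).csInf_mem ?_
      ⟨τ, fun t ht => ht.1⟩
    rw [← hset]
    exact hx.exists_root hτ.1
  exact ⟨hmem.1, hmem.2⟩

lemma IsPsiSol.hasDerivAt_of_lt {τ ρ : ℝ} {x ψ : ℝ → ℝ} (hx : Continuous x)
    (hψ : IsPsiSol τ ρ x ψ) {t : ℝ} (h0 : 0 < t) (ht : t < τ) :
    HasDerivAt ψ (max (x (ρ + t - τ)) (ψ t)) t := by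
  obtain ⟨hc, -, hi, -⟩ := hψ
  have hc' : ContinuousOn (fun s => max (x (ρ + s - τ)) (ψ s)) (Ici 0) := by
    refine ContinuousOn.sup ?_ hc
    exact (hx.comp (by fun_prop : Continuous fun s => ρ + s - τ)).continuousOn
  have hint : IntervalIntegrable (fun s => max (x (ρ + s - τ)) (ψ s)) volume 0 t := by
    refine (hc'.mono ?_).intervalIntegrable
    rw [uIcc_of_le h0.le]
    exact Icc_subset_Ici_self
  have h := intervalIntegral.integral_hasDerivAt_right hint
    ((hc'.mono Ioi_subset_Ici_self).stronglyMeasurableAtFilter isOpen_Ioi t h0)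
    (hc'.continuousAt (Ici_mem_nhds h0))
  refine h.congr_of_eventuallyEq ?_
  filter_upwards [Ioo_mem_nhds h0 ht] with s hs using hi s ⟨hs.1.le, hs.2.le⟩

lemma IsPsiSol.hasDerivAt_of_gt {τ ρ : ℝ} {x ψ : ℝ → ℝ} (hτ : 0 < τ)
    (hψ : IsPsiSol τ ρ x ψ) {t : ℝ} (ht : τ < t) : HasDerivAt ψ (ψ t) t := by
  obtain ⟨hc, -, -, hi⟩ := hψ
  have hint : IntervalIntegrable ψ volume τ t := by
    refine (hc.mono ?_).intervalIntegrable
    rw [uIcc_of_le ht.le]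
    exact Icc_subset_Ici_self.trans (Ici_subset_Ici.2 hτ.le)
  have h := (intervalIntegral.integral_hasDerivAt_right hint
    ((hc.mono Ioi_subset_Ici_self).stronglyMeasurableAtFilter isOpen_Ioi t (hτ.trans ht))
    (hc.continuousAt (Ici_mem_nhds (hτ.trans ht)))).const_add (ψ τ)
  refine h.congr_of_eventuallyEq ?_
  filter_upwards [lt_mem_nhds ht] with s hs using hi s hs.le

lemma IsPsiSol.one_lt {τ ρ : ℝ} {x ψ : ℝ → ℝ} (hτ : 0 < τ) (hx : Continuous x)
    (hψ : IsPsiSol τ ρ x ψ) {s t : ℝ} (hs : 0 < s) (hs1 : ψ s = 1) (hst : s < t) : 1 < ψ t := by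
  have hc : ContinuousOn (fun u => ψ u * Real.exp (-u)) (Ici 0) :=
    hψ.1.mul (by fun_prop)
  have hderiv : ∀ u, 0 < u → u ≠ τ → ∃ v, HasDerivAt ψ v u ∧ ψ u ≤ v := by
    intro u hu hne
    rcases lt_or_gt_of_ne hne with h | h
    · exact ⟨_, hψ.hasDerivAt_of_lt hx hu h, le_max_right _ _⟩
    · exact ⟨_, hψ.hasDerivAt_of_gt hτ h, le_rfl⟩
  have hmono : ∀ D : Set ℝ, Convex ℝ D → D ⊆ Ici 0 → interior D ⊆ Ioi 0 → τ ∉ interior D →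
      MonotoneOn (fun u => ψ u * Real.exp (-u)) D := by
    intro D hD hD0 hint hτD
    have key : ∀ u ∈ interior D, ∃ w, HasDerivAt (fun u => ψ u * Real.exp (-u)) w u ∧ 0 ≤ w := by
      intro u hu
      obtain ⟨v, hv, hle⟩ := hderiv u (hint hu) (fun h => hτD (h ▸ hu))
      refine ⟨_, hv.mul (hasDerivAt_neg u).exp, ?_⟩
      nlinarith [Real.exp_pos (-u)]
    refine monotoneOn_of_deriv_nonneg hD (hc.mono hD0) ?_ ?_
    · intro u hu
      obtain ⟨w, hw, -⟩ := key u hu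
      exact hw.differentiableAt.differentiableWithinAt
    · intro u hu
      obtain ⟨w, hw, hw0⟩ := key u hu
      rwa [hw.deriv]
  have h1 := hmono (Icc 0 τ) (convex_Icc _ _) Icc_subset_Ici_self
    (by rw [interior_Icc]; exact fun u hu => hu.1) (by rw [interior_Icc]; simp)
  have h2 := hmono (Ici τ) (convex_Ici _) (Ici_subset_Ici.2 hτ.le)
    (by rw [interior_Ici]; exact Ioi_subset_Ioi hτ.le) (by rw [interior_Ici]; simp)
  have h3 := h1.union_right h2 (isGreatest_Icc hτ.le) isLeast_Ici
  rw [Icc_union_Ici_eq_Ici hτ.le] at h3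
  have h4 := h3 hs.le (hs.trans hst).le hst.le
  simp only [hs1, one_mul] at h4
  have h5 : Real.exp (-t) < Real.exp (-s) := Real.exp_lt_exp.2 (by linarith)
  by_contra! h6
  nlinarith [Real.exp_pos (-t)]

/-- The extension of a profile `φ` on `[0, α]` to the line that is multiplied by `c` over each
step of length `α`. -/
def scaledExtension (α c : ℝ) (φ : ℝ → ℝ) (t : ℝ) : ℝ :=
  c ^ ⌊t / α⌋ * φ (t - ⌊t / α⌋ * α)

section scaledExtension

variable {α c : ℝ} {φ : ℝ → ℝ}

lemma floor_div_eq (hα : 0 < α) {k : ℤ} {t : ℝ} (h0 : k * α ≤ t) (h1 : t < k * α + α) :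
    ⌊t / α⌋ = k := by
  rw [Int.floor_eq_iff, le_div_iff₀ hα, div_lt_iff₀ hα]
  constructor <;> linarith

lemma floor_div_bounds (hα : 0 < α) (t : ℝ) :
    ⌊t / α⌋ * α ≤ t ∧ t < ⌊t / α⌋ * α + α := by
  have h0 := Int.floor_le (t / α)
  have h1 := Int.lt_floor_add_one (t / α)
  rw [le_div_iff₀ hα] at h0
  rw [div_lt_iff₀ hα] at h1
  constructor <;> linarith

lemma scaledExtension_eq (hα : 0 < α) (hc : c ≠ 0) (hφ : φ α = c * φ 0) {k : ℤ} {t : ℝ}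
    (ht : t ∈ Icc (k * α) (k * α + α)) : scaledExtension α c φ t = c ^ k * φ (t - k * α) := by
  rcases ht.2.lt_or_eq with h | h
  · rw [scaledExtension, floor_div_eq hα ht.1 h]
  · have hk : ⌊t / α⌋ = k + 1 :=
      floor_div_eq hα (by push_cast; linarith) (by push_cast; linarith)
    rw [scaledExtension, hk, h, zpow_add_one₀ hc]
    push_cast
    rw [show k * α + α - (k + 1) * α = 0 by ring, show k * α + α - k * α = α by ring, hφ]
    ring

lemma continuous_scaledExtension (hα : 0 < α) (hc : c ≠ 0) (hφ : φ α = c * φ 0)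
    (hcont : Continuous φ) : Continuous (scaledExtension α c φ) := by
  have hon : ∀ k : ℤ, ContinuousOn (scaledExtension α c φ) (Icc (k * α) (k * α + α)) := fun k =>
    (by fun_prop : Continuous fun t => c ^ k * φ (t - k * α)).continuousOn.congr
      fun t ht => scaledExtension_eq hα hc hφ ht
  rw [continuous_iff_continuousAt]
  intro t
  obtain ⟨h0, h1⟩ := floor_div_bounds hα t
  set k := ⌊t / α⌋
  have hu := (hon (k - 1)).union_of_isClosed (hon k) isClosed_Icc isClosed_Icc
  push_cast at hu
  rw [show (k - 1) * α + α = k * α by ring,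
    Icc_union_Icc_eq_Icc (by linarith) (by linarith)] at hu
  exact hu.continuousAt (Icc_mem_nhds (by linarith) h1)

end scaledExtension

theorem stmt13 (τ : ℝ) (hτ : τ ∈ Ioc (1 / Real.exp 1) 1)
    (xτ : ℝ → ℝ) (hx : IsXSol τ xτ) (ρ : ℝ) (hρ : ρ = firstRoot xτ)
    (ψ : ℝ → ℝ) (hψ : IsPsiSol τ ρ xτ ψ)
    (Λτ : ℝ) (hΛ : ρ < Λτ ∧ ψ (Λτ - ρ) = 1)
    (α r : ℝ) (hα : Λτ < α) (hr : τ < r) :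
    ∃ p τd x : ℝ → ℝ,
      Measurable p ∧ Measurable τd ∧
      (∀ t, |p t| = 1) ∧ (∀ t, τd t ≤ t) ∧
      (∀ t ≥ (0:ℝ), t - τd t ≤ r) ∧
      Filter.Tendsto τd Filter.atTop Filter.atTop ∧
      IsDelaySolution p τd 0 x ∧
      AlphaOscillating α x ∧
      (∀ B : ℝ, ∃ t ≥ (0:ℝ), B < |x t|) := by
  have hτ0 : 0 < τ := lt_trans (by positivity) hτ.1
  obtain ⟨hτρ, hroot⟩ := hx.firstRoot_spec hτ
  rw [← hρ] at hτρ hroot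
  have hρα : ρ < α := hΛ.1.trans hα
  have hα0 : 0 < α := by linarith
  have hxc := hx.1
  set q := ψ (α - ρ)
  have hq : 1 < q := hψ.one_lt hτ0 hxc (by linarith [hΛ.1]) hΛ.2 (by linarith)
  have hq0 : -q ≠ 0 := by linarith
  -- One cycle: descend along `xτ` to its root, then follow `-ψ`.
  let Ψ : ℝ → ℝ := fun s => ψ (max 0 s)
  have hΨc : Continuous Ψ :=
    hψ.1.comp_continuous (by fun_prop) fun s => mem_Ici.2 (le_max_left _ _)
  let φ : ℝ → ℝ := fun u => xτ (min u ρ) - Ψ (u - ρ)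
  have hφc : Continuous φ := by fun_prop
  have hφ_le : ∀ u ≤ ρ, φ u = xτ u := fun u hu => by
    simp only [φ, Ψ, min_eq_left hu, max_eq_left (sub_nonpos.2 hu), hψ.2.1, sub_zero]
  have hφ_ge : ∀ u, ρ ≤ u → φ u = -ψ (u - ρ) := fun u hu => by
    simp only [φ, Ψ, min_eq_right hu, max_eq_right (sub_nonneg.2 hu), hroot, zero_sub]
  have hφ0 : φ 0 = 1 := by rw [hφ_le 0 (by linarith), hx.2.1 0 le_rfl]
  have hφα : φ α = -q * φ 0 := by rw [hφ0, hφ_ge α hρα.le, mul_one]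
  -- The phases in which the equation looks back in time.
  let A : Set ℝ := {u | u < ρ ∨ (u < ρ + τ ∧ Ψ (u - ρ) ≤ xτ (u - τ))}
  have hA : MeasurableSet A :=
    (measurableSet_lt measurable_id measurable_const).union
      ((measurableSet_lt measurable_id measurable_const).inter
        (measurableSet_le (f := fun u => Ψ (u - ρ)) (g := fun u => xτ (u - τ))
          (by fun_prop) (by fun_prop)))
  classical
  let P : ℝ → ℝ := fun u => if u ∈ A then -1 else 1
  let D : ℝ → ℝ := fun u => if u ∈ A then min u τ else 0
  have hPm : Measurable P := Measurable.ite hA measurable_const measurable_const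
  have hDm : Measurable D := Measurable.ite hA (by fun_prop) measurable_const
  have hD : ∀ u, 0 ≤ u → 0 ≤ D u ∧ D u ≤ u ∧ D u ≤ τ := by
    intro u hu
    by_cases h : u ∈ A
    · simp only [D, if_pos h]
      exact ⟨le_min hu hτ0.le, min_le_left _ _, min_le_right _ _⟩
    · simp only [D, if_neg h]
      exact ⟨le_rfl, hu, hτ0.le⟩
  have hφd : ∀ u, 0 < u → u ≠ ρ → u ≠ ρ + τ → HasDerivAt φ (P u * φ (u - D u)) u := by
    intro u hu hu1 hu2
    have hback : u ∈ A → u < ρ + τ → P u * φ (u - D u) = -xτ (u - τ) := by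
      intro h hlt
      simp only [P, D, if_pos h]
      rcases le_total u τ with h' | h'
      · rw [min_eq_left h', sub_self, hφ0, hx.2.1 (u - τ) (by linarith)]; ring
      · rw [min_eq_right h', hφ_le _ (by linarith)]; ring
    have hstay : u ∉ A → ρ ≤ u → P u * φ (u - D u) = -ψ (u - ρ) := by
      intro h hle
      simp only [P, D, if_neg h]
      rw [sub_zero, hφ_ge u hle, one_mul]
    rcases lt_or_gt_of_ne hu1 with h | h
    · rw [hback (Or.inl h) (by linarith)]
      refine (hx.hasDerivAt hu).congr_of_eventuallyEq ?_
      filter_upwards [gt_mem_nhds h] with s hs using hφ_le s hs.le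
    · have hev : φ =ᶠ[nhds u] fun s => -ψ (s - ρ) := by
        filter_upwards [lt_mem_nhds h] with s hs using hφ_ge s hs.le
      have hΨu : Ψ (u - ρ) = ψ (u - ρ) := by
        simp only [Ψ, max_eq_right (sub_nonneg.2 h.le)]
      rcases lt_or_gt_of_ne hu2 with h' | h'
      · have hd := ((hψ.hasDerivAt_of_lt hxc (t := u - ρ) (by linarith)
          (by linarith)).comp_sub_const u ρ).neg
        rw [show ρ + (u - ρ) - τ = u - τ by ring] at hd
        by_cases hc : Ψ (u - ρ) ≤ xτ (u - τ)
        · rw [hback (Or.inr ⟨h', hc⟩) h']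
          rw [hΨu] at hc
          rw [max_eq_left hc] at hd
          exact hd.congr_of_eventuallyEq hev
        · rw [hstay (fun hu => hu.elim (fun h'' => by linarith) fun h'' => hc h''.2) h.le]
          rw [hΨu, not_le] at hc
          rw [max_eq_right hc.le] at hd
          exact hd.congr_of_eventuallyEq hev
      · have hd := ((hψ.hasDerivAt_of_gt hτ0 (t := u - ρ)
          (by linarith)).comp_sub_const u ρ).neg
        rw [hstay (fun hu => hu.elim (fun h'' => by linarith) fun h'' => by linarith [h''.1])
          h.le]
        exact hd.congr_of_eventuallyEq hev
  let x := scaledExtension α (-q) φ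
  have hxcont : Continuous x := continuous_scaledExtension hα0 hq0 hφα hφc
  have hxeq : ∀ (k : ℤ) (u : ℝ), 0 ≤ u → u ≤ α → x (k * α + u) = (-q) ^ k * φ u := by
    intro k u h0 h1
    have := scaledExtension_eq hα0 hq0 hφα (k := k) (t := k * α + u)
      ⟨by linarith, by linarith⟩
    rwa [add_sub_cancel_left] at this
  let ph : ℝ → ℝ := fun t => t - ⌊t / α⌋ * α
  have hphm : Measurable ph := by fun_prop
  have hph : ∀ t, 0 ≤ ph t ∧ ph t < α := fun t => by
    have := floor_div_bounds hα0 t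
    constructor <;> simp only [ph] <;> linarith
  have hpm : Measurable fun t => P (ph t) := hPm.comp hphm
  have hτm : Measurable fun t => t - D (ph t) := measurable_id.sub (hDm.comp hphm)
  have hPabs : ∀ u, |P u| = 1 := fun u => by
    simp only [P]; split_ifs <;> simp
  refine ⟨fun t => P (ph t), fun t => t - D (ph t), x, hpm, hτm, fun t => hPabs _,
    fun t => by linarith [(hD _ (hph t).1).1], fun t _ => by linarith [(hD _ (hph t).1).2.2],
    ?_, ⟨hxcont, fun t ht => ?_⟩, ?_, ?_⟩
  · refine tendsto_atTop_mono (fun t => ?_) (tendsto_atTop_add_const_right _ (-τ) tendsto_id)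
    simp only [id]
    linarith [(hD _ (hph t).1).2.2]
  · have hint : IntervalIntegrable (fun s => P (ph s) * x (s - D (ph s))) volume 0 t := by
      obtain ⟨C, hC⟩ := (isCompact_Icc (a := -τ) (b := t)).exists_bound_of_continuousOn
        hxcont.continuousOn
      rw [intervalIntegrable_iff]
      refine Measure.integrableOn_of_bounded (M := C) (by simp)
        (hpm.mul (hxcont.measurable.comp hτm)).aestronglyMeasurable ?_
      refine (ae_restrict_iff' measurableSet_uIoc).2 (Eventually.of_forall fun s hs => ?_)
      rw [uIoc_of_le ht] at hs
      have hDs := hD _ (hph s).1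
      rw [norm_mul, Real.norm_eq_abs, hPabs, one_mul]
      exact hC _ ⟨by linarith [hs.1], by linarith [hs.2]⟩
    let S : Set ℝ := ⋃ k : ℤ, {k * α, k * α + ρ, k * α + (ρ + τ)}
    have hS : S.Countable := countable_iUnion fun k => Set.Finite.countable (by simp)
    have hFTC := integral_eq_of_hasDerivAt_off_countable x
      (fun s => P (ph s) * x (s - D (ph s))) hS hxcont.continuousOn (a := 0) (b := t)
      (fun s hs => ?_) hint
    · rw [hFTC]; ring
    · have hsS : ∀ k : ℤ, s ≠ k * α ∧ s ≠ k * α + ρ ∧ s ≠ k * α + (ρ + τ) := by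
        intro k
        have := fun h => hs.2 (mem_iUnion.2 ⟨k, h⟩)
        simpa using this
      obtain ⟨h0, h1⟩ := floor_div_bounds hα0 s
      have hphs : ph s = s - ⌊s / α⌋ * α := rfl
      obtain ⟨n0, n1, n2⟩ := hsS ⌊s / α⌋
      generalize ⌊s / α⌋ = k at *
      have hlt : k * α < s := lt_of_le_of_ne h0 n0.symm
      have hDs := hD _ (hph s).1
      have hval : x (s - D (ph s)) = (-q) ^ k * φ (ph s - D (ph s)) := by
        rw [← hxeq k _ (by linarith) (by linarith [(hph s).2])]
        congr 1
        rw [hphs]; ring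
      have hd := hφd (ph s) (by linarith) (fun h => n1 (by linarith))
        (fun h => n2 (by linarith))
      rw [hphs] at hd
      have hd' := (hd.comp_sub_const s (k * α)).const_mul ((-q) ^ k)
      rw [hval, hphs, mul_left_comm]
      refine hd'.congr_of_eventuallyEq ?_
      filter_upwards [Icc_mem_nhds hlt h1] with u hu
      exact scaledExtension_eq hα0 hq0 hφα hu
  · refine ⟨0, fun a b _ hab hne => ?_⟩
    by_contra! hlen
    obtain ⟨h0, h1⟩ := floor_div_bounds hα0 (a - ρ)
    set k := ⌊(a - ρ) / α⌋
    refine hne (((k + 1 : ℤ) : ℝ) * α + ρ) ⟨?_, ?_⟩ ?_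
    · push_cast; linarith
    · push_cast; linarith
    · rw [hxeq _ ρ (by linarith) hρα.le, hφ_le ρ le_rfl, hroot, mul_zero]
  · intro B
    obtain ⟨n, hn⟩ := pow_unbounded_of_one_lt B hq
    refine ⟨((n : ℤ) : ℝ) * α + 0, by positivity, ?_⟩
    rw [hxeq _ 0 le_rfl hα0.le, hφ0, mul_one, zpow_natCast, abs_pow, abs_neg,
      abs_of_pos (by linarith)]
    exact hn
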